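/- (Proposition 2) Let n ≥ 2, let Ω ⊆ ℝⁿ be an open set, and let f : Ω → ℝ be a smooth function whose Hessian matrix H(x) = (∂²f/∂xᵢ∂xⱼ(x)) is positive definite at every x ∈ Ω. Assume the affine Kähler scalar curvature S = −(1/2) Σᵢⱼ H^{ij} ∂ᵢ∂ⱼ(log det H) vanishes identically on Ω. Set ρ = (det H)^{−1/(n+2)} and Φ = (Σᵢⱼ H^{ij} ∂ᵢρ ∂ⱼρ)/ρ². Then at every point p ∈ Ω with Φ(p) > 0: Δ_g Φ ≥ (n/(2(n−1))) · ‖∇Φ‖²_g / Φ + ((n²−4)/(n−1)) · ⟨∇Φ, ∇log ρ⟩_g + ((n+2)²/2) · (1/(n−1) − (n−1)/(4n)) · Φ², where for smooth u, v: ‖∇u‖²_g = Σᵢⱼ H^{ij} ∂ᵢu ∂ⱼu, ⟨∇u, ∇v⟩_g = Σᵢⱼ H^{ij} ∂ᵢu ∂ⱼv, and Δ_g u = (det H)^{−1/2} Σᵢ ∂ᵢ( (det H)^{1/2} Σⱼ H^{ij} ∂ⱼu ). -/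

import Mathlib

open Matrix

/-- Partial derivative `∂u/∂xᵢ` of a function `u : ℝⁿ → ℝ`. -/
noncomputable def pder (n : ℕ) (i : Fin n) (u : (Fin n → ℝ) → ℝ) (x : Fin n → ℝ) : ℝ :=
  fderiv ℝ u x (Pi.single i 1)

/-- Hessian matrix `H(x) = (∂²f/∂xᵢ∂xⱼ(x))`. -/
noncomputable def Hess (n : ℕ) (f : (Fin n → ℝ) → ℝ) (x : Fin n → ℝ) :
    Matrix (Fin n) (Fin n) ℝ :=
  Matrix.of fun i j => pder n i (pder n j f) x

/-- `ρ = (det H)^(−1/(n+2))`. -/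
noncomputable def rho (n : ℕ) (f : (Fin n → ℝ) → ℝ) (x : Fin n → ℝ) : ℝ :=
  (Hess n f x).det ^ (-(1 : ℝ) / ((n : ℝ) + 2))

/-- `⟨∇u, ∇v⟩_g = Σᵢⱼ H^{ij} ∂ᵢu ∂ⱼv` with respect to the Calabi metric of `f`. -/
noncomputable def gradInner (n : ℕ) (f u v : (Fin n → ℝ) → ℝ) (x : Fin n → ℝ) : ℝ :=
  ∑ i, ∑ j, (Hess n f x)⁻¹ i j * pder n i u x * pder n j v x

/-- `Φ = ‖∇ρ‖²_g / ρ²`. -/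
noncomputable def Phi (n : ℕ) (f : (Fin n → ℝ) → ℝ) (x : Fin n → ℝ) : ℝ :=
  gradInner n f (rho n f) (rho n f) x / (rho n f x) ^ 2

/-- Laplace–Beltrami operator of the Calabi metric:
`Δ_g u = (det H)^{−1/2} Σᵢ ∂ᵢ( (det H)^{1/2} Σⱼ H^{ij} ∂ⱼu )`. -/
noncomputable def lapBel (n : ℕ) (f u : (Fin n → ℝ) → ℝ) (x : Fin n → ℝ) : ℝ :=
  (Hess n f x).det ^ (-(1 : ℝ) / 2) *
    ∑ i, pder n i (fun y => (Hess n f y).det ^ ((1 : ℝ) / 2) *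
      ∑ j, (Hess n f y)⁻¹ i j * pder n j u y) x

/-- Completeness of the Calabi metric `g = Σ fᵢⱼ dxᵢ dxⱼ` on `Ω`: every C¹ curve
`γ : [0,1) → Ω` eventually leaving every compact subset of `Ω` has infinite length. -/
def CalabiComplete (n : ℕ) (Ω : Set (Fin n → ℝ)) (f : (Fin n → ℝ) → ℝ) : Prop :=
  ∀ γ : ℝ → (Fin n → ℝ), ContDiffOn ℝ 1 γ (Set.Ico (0 : ℝ) 1) →
    (∀ t ∈ Set.Ico (0 : ℝ) 1, γ t ∈ Ω) →
    (∀ K : Set (Fin n → ℝ), K ⊆ Ω → IsCompact K →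
      ∃ t₀, t₀ < 1 ∧ ∀ t, t₀ < t → t < 1 → γ t ∉ K) →
    ∫⁻ t in Set.Ioo (0 : ℝ) 1,
      ENNReal.ofReal (Real.sqrt ((Hess n f (γ t)).mulVec (deriv γ t) ⬝ᵥ deriv γ t)) = ⊤

/-- `f` coincides on `Ω` with a quadratic polynomial with symmetric positive definite
quadratic part. -/
def IsQuadraticOn (n : ℕ) (Ω : Set (Fin n → ℝ)) (f : (Fin n → ℝ) → ℝ) : Prop :=
  ∃ A : Matrix (Fin n) (Fin n) ℝ, A.IsSymm ∧ A.PosDef ∧ ∃ b : Fin n → ℝ, ∃ c : ℝ,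
    ∀ x ∈ Ω, f x = (1 / 2) * (A.mulVec x ⬝ᵥ x) + b ⬝ᵥ x + c

section helpers

variable {n : ℕ} {Ω : Set (Fin n → ℝ)}

theorem Sm.dAt (hΩ : IsOpen Ω) {u : (Fin n → ℝ) → ℝ} (hu : ContDiffOn ℝ (⊤ : ℕ∞) u Ω)
    {x : Fin n → ℝ} (hx : x ∈ Ω) : DifferentiableAt ℝ u x :=
  (hu.differentiableOn (by simp)).differentiableAt (hΩ.mem_nhds hx)

theorem Sm.pder (hΩ : IsOpen Ω) {u : (Fin n → ℝ) → ℝ} (hu : ContDiffOn ℝ (⊤ : ℕ∞) u Ω)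
    (i : Fin n) : ContDiffOn ℝ (⊤ : ℕ∞) (pder n i u) Ω := by
  have h := ((contDiffOn_infty_iff_fderiv_of_isOpen hΩ).1 hu).2
  exact h.clm_apply contDiffOn_const

theorem pder_congr (hΩ : IsOpen Ω) {u v : (Fin n → ℝ) → ℝ} (h : ∀ x ∈ Ω, u x = v x)
    {x : Fin n → ℝ} (hx : x ∈ Ω) (i : Fin n) : pder n i u x = pder n i v x := by
  unfold pder
  rw [Filter.EventuallyEq.fderiv_eq]
  filter_upwards [hΩ.mem_nhds hx] with y hy using h y hy

theorem pder_add' {u v : (Fin n → ℝ) → ℝ} {x : Fin n → ℝ} (hu : DifferentiableAt ℝ u x)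
    (hv : DifferentiableAt ℝ v x) (i : Fin n) :
    pder n i (fun y => u y + v y) x = pder n i u x + pder n i v x := by
  simp [pder, fderiv_fun_add hu hv]

theorem pder_sub' {u v : (Fin n → ℝ) → ℝ} {x : Fin n → ℝ} (hu : DifferentiableAt ℝ u x)
    (hv : DifferentiableAt ℝ v x) (i : Fin n) :
    pder n i (fun y => u y - v y) x = pder n i u x - pder n i v x := by
  simp [pder, fderiv_fun_sub hu hv]

theorem pder_mul' {u v : (Fin n → ℝ) → ℝ} {x : Fin n → ℝ} (hu : DifferentiableAt ℝ u x)
    (hv : DifferentiableAt ℝ v x) (i : Fin n) :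
    pder n i (fun y => u y * v y) x = pder n i u x * v x + u x * pder n i v x := by
  simp [pder, fderiv_fun_mul hu hv]; ring

theorem pder_cmul' {u : (Fin n → ℝ) → ℝ} {x : Fin n → ℝ} (hu : DifferentiableAt ℝ u x)
    (c : ℝ) (i : Fin n) :
    pder n i (fun y => c * u y) x = c * pder n i u x := by
  simp [pder, fderiv_const_mul hu]

theorem pder_const' (c : ℝ) (i : Fin n) (x : Fin n → ℝ) :
    pder n i (fun _ => c) x = 0 := by
  simp [pder]

theorem pder_sum' {ι : Type*} {s : Finset ι} {u : ι → (Fin n → ℝ) → ℝ} {x : Fin n → ℝ}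
    (hu : ∀ k ∈ s, DifferentiableAt ℝ (u k) x) (i : Fin n) :
    pder n i (fun y => ∑ k ∈ s, u k y) x = ∑ k ∈ s, pder n i (u k) x := by
  simp [pder, fderiv_fun_sum hu]

theorem pder_comm' (hΩ : IsOpen Ω) {u : (Fin n → ℝ) → ℝ} (hu : ContDiffOn ℝ (⊤ : ℕ∞) u Ω)
    {x : Fin n → ℝ} (hx : x ∈ Ω) (i j : Fin n) :
    pder n i (pder n j u) x = pder n j (pder n i u) x := by
  have h1 : ContDiffAt ℝ (⊤ : ℕ∞) u x := hu.contDiffAt (hΩ.mem_nhds hx)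
  have h2 := h1.isSymmSndFDerivAt (by
    rw [minSmoothness_of_isRCLikeNormedField]
    exact WithTop.coe_le_coe.2 (le_top : (2 : ℕ∞) ≤ ⊤))
  have h3 : DifferentiableAt ℝ (fderiv ℝ u) x :=
    ((((contDiffOn_infty_iff_fderiv_of_isOpen hΩ).1 hu).2).differentiableOn
      (by simp)).differentiableAt (hΩ.mem_nhds hx)
  have key : ∀ a b : Fin n, pder n a (pder n b u) x =
      fderiv ℝ (fderiv ℝ u) x (Pi.single a 1) (Pi.single b 1) := by
    intro a b
    have : pder n b u = fun y => fderiv ℝ u y (Pi.single b 1) := rfl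
    rw [this]
    unfold pder
    rw [fderiv_clm_apply h3 (differentiableAt_const _)]
    simp
  rw [key, key]
  exact h2 _ _

theorem Sm.det {M : (Fin n → ℝ) → Matrix (Fin n) (Fin n) ℝ}
    (hM : ∀ i j, ContDiffOn ℝ (⊤ : ℕ∞) (fun y => M y i j) Ω) :
    ContDiffOn ℝ (⊤ : ℕ∞) (fun y => (M y).det) Ω := by
  simp only [Matrix.det_apply']
  exact ContDiffOn.sum fun σ _ => contDiffOn_const.mul (contDiffOn_prod fun i _ => hM _ _)

theorem dAt_prod {u : Fin n → (Fin n → ℝ) → ℝ} {x : Fin n → ℝ}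
    (hu : ∀ k, DifferentiableAt ℝ (u k) x) (s : Finset (Fin n)) :
    DifferentiableAt ℝ (fun y => ∏ k ∈ s, u k y) x :=
  (HasFDerivAt.finsetProd (u := s) (fun k _ => (hu k).hasFDerivAt)).differentiableAt

theorem pder_prod' {u : Fin n → (Fin n → ℝ) → ℝ} {x : Fin n → ℝ}
    (hu : ∀ k, DifferentiableAt ℝ (u k) x) (i : Fin n) (s : Finset (Fin n)) :
    pder n i (fun y => ∏ k ∈ s, u k y) x =
      ∑ k ∈ s, pder n i (u k) x * ∏ l ∈ s.erase k, u l x := by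
  have := HasFDerivAt.finsetProd (u := s) (fun k _ => (hu k).hasFDerivAt)
  unfold pder
  rw [this.fderiv]
  simp [mul_comm]

theorem pder_det {M : (Fin n → ℝ) → Matrix (Fin n) (Fin n) ℝ} {x : Fin n → ℝ}
    (hM : ∀ i j, DifferentiableAt ℝ (fun y => M y i j) x) (m : Fin n) :
    pder n m (fun y => (M y).det) x =
      ∑ i, ∑ j, (M x).adjugate i j * pder n m (fun y => M y j i) x := by
  have h1 : ∀ i, ∑ j, (M x).adjugate i j * pder n m (fun y => M y j i) x
      = ((M x).updateCol i (fun j => pder n m (fun y => M y j i) x)).det := by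
    intro i
    rw [← Matrix.cramer_apply, Matrix.cramer_eq_adjugate_mulVec]
    rfl
  simp only [h1]
  simp only [Matrix.det_apply']
  rw [pder_sum', Finset.sum_comm]
  · refine Finset.sum_congr rfl fun σ _ => ?_
    rw [pder_cmul', pder_prod' (u := fun k y => M y (σ k) k) (fun k => hM _ _), Finset.mul_sum]
    · refine Finset.sum_congr rfl fun k _ => ?_
      congr 1
      rw [← Finset.mul_prod_erase _ _ (Finset.mem_univ k)]
      congr 1
      · simp
      · refine Finset.prod_congr rfl fun l hl => ?_
        rw [Matrix.updateCol_ne (Finset.ne_of_mem_erase hl)]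
    · exact dAt_prod (u := fun k y => M y (σ k) k) (fun k => hM _ _) _
  · intro σ _
    exact (differentiableAt_const _).mul (dAt_prod (u := fun k y => M y (σ k) k) (fun k => hM _ _) _)

theorem Sm.inv {M : (Fin n → ℝ) → Matrix (Fin n) (Fin n) ℝ}
    (hM : ∀ i j, ContDiffOn ℝ (⊤ : ℕ∞) (fun y => M y i j) Ω)
    (hd : ∀ y ∈ Ω, (M y).det ≠ 0) (i j : Fin n) :
    ContDiffOn ℝ (⊤ : ℕ∞) (fun y => (M y)⁻¹ i j) Ω := by
  have : ∀ y, (M y)⁻¹ i j = ((M y).det)⁻¹ * ((M y).updateRow j (Pi.single i 1)).det := by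
    intro y
    rw [Matrix.inv_def, Matrix.smul_apply, Matrix.adjugate_apply, Ring.inverse_eq_inv', smul_eq_mul]
  simp only [this]
  refine ((Sm.det hM).inv hd).mul (Sm.det ?_)
  intro a b
  by_cases h : a = j
  · subst h; simp only [Matrix.updateRow_self]; exact contDiffOn_const
  · simp only [Matrix.updateRow_ne h]; exact hM a b

theorem pder_inv (hΩ : IsOpen Ω) {M : (Fin n → ℝ) → Matrix (Fin n) (Fin n) ℝ}
    (hM : ∀ i j, ContDiffOn ℝ (⊤ : ℕ∞) (fun y => M y i j) Ω)
    (hd : ∀ y ∈ Ω, (M y).det ≠ 0) {x : Fin n → ℝ} (hx : x ∈ Ω) (m : Fin n) :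
    (Matrix.of fun i j => pder n m (fun y => (M y)⁻¹ i j) x) =
      - ((M x)⁻¹ * (Matrix.of fun i j => pder n m (fun y => M y i j) x) * (M x)⁻¹) := by
  set D := Matrix.of fun i j => pder n m (fun y => (M y)⁻¹ i j) x with hD
  set F := Matrix.of fun i j => pder n m (fun y => M y i j) x with hF
  have hu : ∀ y ∈ Ω, IsUnit (M y).det := fun y hy => isUnit_iff_ne_zero.2 (hd y hy)
  have h1 : D * M x + (M x)⁻¹ * F = 0 := by
    ext i j
    have e : pder n m (fun y => ∑ k, (M y)⁻¹ i k * M y k j) x = 0 := by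
      rw [pder_congr hΩ (v := fun _ => (1 : Matrix (Fin n) (Fin n) ℝ) i j) _ hx, pder_const']
      intro y hy
      rw [← Matrix.nonsing_inv_mul (M y) (hu y hy), Matrix.mul_apply]
    rw [pder_sum'] at e
    · rw [Matrix.add_apply, Matrix.mul_apply, Matrix.mul_apply, ← Finset.sum_add_distrib,
        Matrix.zero_apply, ← e]
      refine Finset.sum_congr rfl fun k _ => ?_
      rw [pder_mul' (Sm.dAt hΩ (Sm.inv hM hd _ _) hx) (Sm.dAt hΩ (hM _ _) hx)]
      rfl
    · intro k _
      exact (Sm.dAt hΩ (Sm.inv hM hd _ _) hx).mul (Sm.dAt hΩ (hM _ _) hx)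
  have h2 : D * M x = - ((M x)⁻¹ * F) := eq_neg_of_add_eq_zero_left h1
  calc D = D * M x * (M x)⁻¹ := by
        rw [Matrix.mul_assoc, Matrix.mul_nonsing_inv _ (hu x hx), Matrix.mul_one]
    _ = _ := by rw [h2, Matrix.neg_mul]

theorem frob_lower (m : ℝ) (hm : m = (n : ℝ)) (hn : 2 ≤ m)
    (A : Matrix (Fin n) (Fin n) ℝ) (hA : A.IsSymm) (v : Fin n → ℝ) (φ : ℝ)
    (hφ : φ = v ⬝ᵥ v) (hpos : 0 < φ) (a q : ℝ) (ha : a * φ = v ⬝ᵥ (A *ᵥ v))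
    (hq : q * φ = (A *ᵥ v) ⬝ᵥ (A *ᵥ v)) :
    2 * q - a ^ 2 + (A.trace - a) ^ 2 / (m - 1) ≤ (A * A).trace := by
  set t := A.trace with ht
  set b := A *ᵥ v with hb
  have hs : ∀ i j, A i j = A j i := fun i j => (hA.apply i j).symm
  set c := (t - a) / (m - 1) with hc
  have h0 : 0 ≤ ∑ i, ∑ j, (A i j - v i * b j / φ - b i * v j / φ + (a + c) * (v i * v j) / φ
      - c * (1 : Matrix (Fin n) (Fin n) ℝ) i j) ^ 2 :=
    Finset.sum_nonneg fun i _ => Finset.sum_nonneg fun j _ => sq_nonneg _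
  have s1 : ∑ i, ∑ j, A i j * A i j = (A * A).trace := by
    simp only [Matrix.trace, Matrix.diag, Matrix.mul_apply]
    refine Finset.sum_congr rfl fun i _ => Finset.sum_congr rfl fun j _ => by rw [hs j i]
  have s2 : ∀ x y : Fin n → ℝ, ∑ i, ∑ j, A i j * (x i * y j) = x ⬝ᵥ (A *ᵥ y) := by
    intro x y
    simp only [dotProduct, Matrix.mulVec, Finset.mul_sum]
    refine Finset.sum_congr rfl fun i _ => Finset.sum_congr rfl fun j _ => by ring
  have s3 : ∀ x y : Fin n → ℝ, x ⬝ᵥ (A *ᵥ y) = (A *ᵥ x) ⬝ᵥ y := by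
    intro x y
    rw [Matrix.dotProduct_mulVec, ← Matrix.mulVec_transpose, hA.eq]
  have s4 : ∀ x y z w : Fin n → ℝ, ∑ i, ∑ j, (x i * y j) * (z i * w j) = (x ⬝ᵥ z) * (y ⬝ᵥ w) := by
    intro x y z w
    simp only [dotProduct, Finset.sum_mul_sum]
    refine Finset.sum_congr rfl fun i _ => Finset.sum_congr rfl fun j _ => by ring
  have s5 : ∀ X : Fin n → Fin n → ℝ, ∑ i, ∑ j, X i j * (1 : Matrix (Fin n) (Fin n) ℝ) i j
      = ∑ i, X i i := by
    intro X
    refine Finset.sum_congr rfl fun i _ => ?_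
    simp [Matrix.one_apply]
  have expand : ∑ i, ∑ j, (A i j - v i * b j / φ - b i * v j / φ + (a + c) * (v i * v j) / φ
      - c * (1 : Matrix (Fin n) (Fin n) ℝ) i j) ^ 2 =
      (∑ i, ∑ j, A i j * A i j) + (1/φ)^2 * (∑ i, ∑ j, (v i * b j) * (v i * b j))
      + (1/φ)^2 * (∑ i, ∑ j, (b i * v j) * (b i * v j))
      + ((a+c)/φ)^2 * (∑ i, ∑ j, (v i * v j) * (v i * v j))
      + c^2 * (∑ i, ∑ j, (1 : Matrix (Fin n) (Fin n) ℝ) i j * (1 : Matrix (Fin n) (Fin n) ℝ) i j)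
      - 2 / φ * (∑ i, ∑ j, A i j * (v i * b j)) - 2 / φ * (∑ i, ∑ j, A i j * (b i * v j))
      + 2 * ((a+c)/φ) * (∑ i, ∑ j, A i j * (v i * v j))
      - 2 * c * (∑ i, ∑ j, A i j * (1 : Matrix (Fin n) (Fin n) ℝ) i j)
      + 2 * (1/φ)^2 * (∑ i, ∑ j, (v i * b j) * (b i * v j))
      - 2 * (1/φ) * ((a+c)/φ) * (∑ i, ∑ j, (v i * b j) * (v i * v j))
      - 2 * (1/φ) * ((a+c)/φ) * (∑ i, ∑ j, (b i * v j) * (v i * v j))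
      + 2 * (1/φ) * c * (∑ i, ∑ j, (v i * b j) * (1 : Matrix (Fin n) (Fin n) ℝ) i j)
      + 2 * (1/φ) * c * (∑ i, ∑ j, (b i * v j) * (1 : Matrix (Fin n) (Fin n) ℝ) i j)
      - 2 * ((a+c)/φ) * c * (∑ i, ∑ j, (v i * v j) * (1 : Matrix (Fin n) (Fin n) ℝ) i j) := by
    simp only [Finset.mul_sum, ← Finset.sum_add_distrib, ← Finset.sum_sub_distrib]
    refine Finset.sum_congr rfl fun i _ => Finset.sum_congr rfl fun j _ => by ring
  rw [expand, s1, s4, s4, s4, s4, s4, s4, s2, s2, s2, s5 (fun i j => (1 : Matrix (Fin n) (Fin n) ℝ) i j), s5 (fun i j => A i j),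
    s5 (fun i j => v i * b j), s5 (fun i j => b i * v j), s5 (fun i j => v i * v j)] at h0
  have d1 : ∑ i, v i * b i = v ⬝ᵥ b := rfl
  have d2 : ∑ i, b i * v i = v ⬝ᵥ b := by rw [dotProduct_comm]; rfl
  have d3 : ∑ i, v i * v i = v ⬝ᵥ v := rfl
  have d4 : ∑ i, A i i = t := rfl
  have d5 : ∑ i, (1 : Matrix (Fin n) (Fin n) ℝ) i i = m := by simp [hm]
  rw [d1, d2, d3, d4, d5, s3 v b, ← hb, dotProduct_comm b v, ← ha, ← hq, ← hφ] at h0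
  have hm1 : 0 < m - 1 := by linarith
  have hct : t = a + c * (m - 1) := by rw [hc]; field_simp; ring
  have hdiv : (t - a) ^ 2 / (m - 1) = c ^ 2 * (m - 1) := by rw [hc]; field_simp
  rw [hdiv]
  have hne : φ ≠ 0 := hpos.ne'
  have : (A * A).trace - (2 * q - a ^ 2 + c ^ 2 * (m - 1)) =
    (A * A).trace + (1 / φ) ^ 2 * (φ * (q * φ)) + (1 / φ) ^ 2 * (q * φ * φ) + ((a + c) / φ) ^ 2 * (φ * φ) + c ^ 2 * m - 2 / φ * (q * φ) - 2 / φ * (q * φ) + 2 * ((a + c) / φ) * (a * φ) - 2 * c * t + 2 * (1 / φ) ^ 2 * (a * φ * (a * φ)) - 2 * (1 / φ) * ((a + c) / φ) * (φ * (a * φ)) - 2 * (1 / φ) * ((a + c) / φ) * (a * φ * φ) + 2 * (1 / φ) * c * (a * φ) + 2 * (1 / φ) * c * (a * φ) - 2 * ((a + c) / φ) * c * φ := by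
    rw [hct]; field_simp; ring
  linarith

theorem cs_aux (v b : Fin n → ℝ) (φ a q : ℝ) (hφ : φ = v ⬝ᵥ v) (hpos : 0 < φ)
    (ha : a * φ = v ⬝ᵥ b) (hq : q * φ = b ⬝ᵥ b) : a ^ 2 ≤ q := by
  have h := Finset.sum_mul_sq_le_sq_mul_sq Finset.univ v b
  have e1 : ∑ i, v i * b i = a * φ := ha.symm
  have e2 : ∑ i, v i ^ 2 = φ := by rw [hφ]; simp [dotProduct, sq]
  have e3 : ∑ i, b i ^ 2 = q * φ := by rw [hq]; simp [dotProduct, sq]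
  rw [e1, e2, e3] at h
  have : a ^ 2 * φ ^ 2 ≤ q * φ ^ 2 := by nlinarith
  exact le_of_mul_le_mul_right this (by positivity)

theorem euclid_ineq (m : ℝ) (hm : m = (n : ℝ)) (hn : 2 ≤ m)
    (W C : Matrix (Fin n) (Fin n) ℝ) (hW : W.IsSymm) (hC : C.IsSymm) (v : Fin n → ℝ) (φ : ℝ)
    (hφ : φ = v ⬝ᵥ v) (hpos : 0 < φ) (tW : W.trace = 0) (tC : C.trace = (m + 2) * φ) :
    m / (2 * (m - 1)) * (((W + C) *ᵥ v) ⬝ᵥ ((W + C) *ᵥ v)) / φ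
      + (m ^ 2 - 4) / (m - 1) * (v ⬝ᵥ ((W + C) *ᵥ v))
      + ((m + 2) ^ 2 / 2) * (1 / (m - 1) - (m - 1) / (4 * m)) * φ ^ 2
    ≤ (W * W).trace + (C * C).trace + (m + 2) * (v ⬝ᵥ (W *ᵥ v))
      + (m + 2) / 2 * (v ⬝ᵥ ((W + C) *ᵥ v)) := by
  have hne : φ ≠ 0 := hpos.ne'
  obtain ⟨a, ha⟩ : ∃ a, a * φ = v ⬝ᵥ (W *ᵥ v) := ⟨_, div_mul_cancel₀ _ hne⟩
  obtain ⟨b, hb⟩ : ∃ a, a * φ = v ⬝ᵥ (C *ᵥ v) := ⟨_, div_mul_cancel₀ _ hne⟩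
  obtain ⟨p, hp⟩ : ∃ a, a * φ = (W *ᵥ v) ⬝ᵥ (W *ᵥ v) := ⟨_, div_mul_cancel₀ _ hne⟩
  obtain ⟨q, hq⟩ : ∃ a, a * φ = (C *ᵥ v) ⬝ᵥ (C *ᵥ v) := ⟨_, div_mul_cancel₀ _ hne⟩
  obtain ⟨r, hr⟩ : ∃ a, a * φ = (W *ᵥ v) ⬝ᵥ (C *ᵥ v) := ⟨_, div_mul_cancel₀ _ hne⟩
  have f1 := frob_lower m hm hn W hW v φ hφ hpos a p ha hp
  have f2 := frob_lower m hm hn C hC v φ hφ hpos b q hb hq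
  have c1 := cs_aux v _ φ a p hφ hpos ha hp
  have c2 := cs_aux v _ φ b q hφ hpos hb hq
  have c3 : (a - b) ^ 2 ≤ p + q - 2 * r := by
    refine cs_aux v (W *ᵥ v - C *ᵥ v) φ _ _ hφ hpos ?_ ?_
    · rw [dotProduct_sub, ← ha, ← hb]; ring
    · rw [dotProduct_sub, sub_dotProduct, sub_dotProduct, dotProduct_comm (C *ᵥ v) (W *ᵥ v),
        ← hp, ← hq, ← hr]; ring
  have e1 : ((W + C) *ᵥ v) ⬝ᵥ ((W + C) *ᵥ v) = (p + q + 2 * r) * φ := by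
    rw [Matrix.add_mulVec, dotProduct_add, add_dotProduct, add_dotProduct,
      dotProduct_comm (C *ᵥ v) (W *ᵥ v), ← hp, ← hq, ← hr]; ring
  have e2 : v ⬝ᵥ ((W + C) *ᵥ v) = (a + b) * φ := by
    rw [Matrix.add_mulVec, dotProduct_add, ← ha, ← hb]; ring
  rw [e1, e2, ← ha]
  rw [tW] at f1
  rw [tC] at f2
  obtain ⟨k, rfl⟩ : ∃ k, m = k + 1 := ⟨m - 1, by ring⟩
  have hk : 1 ≤ k := by linarith
  have hk0 : 0 < k := by linarith
  simp only [add_sub_cancel_right] at *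
  set E := (k + 1 + 2) * φ with hE
  have e3 : (k + 1) / (2 * k) * ((p + q + 2 * r) * φ) / φ = (k + 1) / (2 * k) * (p + q + 2 * r) := by
    field_simp
  rw [e3]
  have g1 : (k + 1) / (2 * k) * (p + q + 2 * r) ≤
      (k + 1) / (2 * k) * (2 * p + 2 * q - (a - b) ^ 2) :=
    mul_le_mul_of_nonneg_left (by linarith) (by positivity)
  have key : (2 * p - a ^ 2 + (0 - a) ^ 2 / k) + (2 * q - b ^ 2 + (E - b) ^ 2 / k) + E * a
      + E / 2 * (a + b) - (k + 1) / (2 * k) * (2 * p + 2 * q - (a - b) ^ 2)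
      - ((k + 1) - 2) / k * E * (a + b) - 1 / 2 * (1 / k - k / (4 * (k + 1))) * E ^ 2
      = (k - 1) / k * ((p - a ^ 2) + (q - b ^ 2)) +
        (k + 1) / (2 * k) * ((a - b) + (k + 2) / (2 * (k + 1)) * E) ^ 2 := by
    field_simp
    ring
  have g2 : 0 ≤ (k - 1) / k * ((p - a ^ 2) + (q - b ^ 2)) +
        (k + 1) / (2 * k) * ((a - b) + (k + 2) / (2 * (k + 1)) * E) ^ 2 := by
    have : 0 ≤ (k - 1) / k := div_nonneg (by linarith) hk0.le
    have := mul_nonneg this (by linarith : 0 ≤ (p - a ^ 2) + (q - b ^ 2))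
    positivity
  have h1 : ((k + 1) ^ 2 - 4) / k * ((a + b) * φ) = ((k + 1) - 2) / k * E * (a + b) := by
    rw [hE]; field_simp; ring
  have h2 : (k + 1 + 2) ^ 2 / 2 * (1 / k - k / (4 * (k + 1))) * φ ^ 2
      = 1 / 2 * (1 / k - k / (4 * (k + 1))) * E ^ 2 := by rw [hE]; ring
  have h3 : (k + 1 + 2) * (a * φ) = E * a := by rw [hE]; ring
  have h4 : (k + 1 + 2) / 2 * ((a + b) * φ) = E / 2 * (a + b) := by rw [hE]; ring
  rw [h1, h2, h3, h4]
  linarith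

open scoped MatrixOrder Matrix.Norms.L2Operator in
theorem metric_ineq (m : ℝ) (hm : m = (n : ℝ)) (hn : 2 ≤ m)
    (G W C : Matrix (Fin n) (Fin n) ℝ) (hG : G.PosSemidef)
    (hW : W.IsSymm) (hC : C.IsSymm) (w v : Fin n → ℝ) (φ : ℝ) (hv : v = G *ᵥ w)
    (hφ : φ = w ⬝ᵥ v) (hpos : 0 < φ) (tW : (G * W).trace = 0)
    (tC : (G * C).trace = (m + 2) * φ) :
    m / (2 * (m - 1)) * (((W + C) *ᵥ v) ⬝ᵥ (G *ᵥ ((W + C) *ᵥ v))) / φ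
      + (m ^ 2 - 4) / (m - 1) * (v ⬝ᵥ ((W + C) *ᵥ v))
      + ((m + 2) ^ 2 / 2) * (1 / (m - 1) - (m - 1) / (4 * m)) * φ ^ 2
    ≤ (G * W * G * W).trace + (G * C * G * C).trace + (m + 2) * (v ⬝ᵥ (W *ᵥ v))
      + (m + 2) / 2 * (v ⬝ᵥ ((W + C) *ᵥ v)) := by
  obtain ⟨S, hS⟩ : ∃ S : Matrix (Fin n) (Fin n) ℝ, G = Sᵀ * S := by
    obtain ⟨S, hS⟩ := CStarAlgebra.nonneg_iff_eq_star_mul_self.mp hG.nonneg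
    exact ⟨S, by rw [hS, Matrix.star_eq_conjTranspose, Matrix.conjTranspose_eq_transpose_of_trivial]⟩
  have hv' : v = Sᵀ *ᵥ (S *ᵥ w) := by rw [hv, hS, Matrix.mulVec_mulVec]
  have tr1 : ∀ X : Matrix (Fin n) (Fin n) ℝ, (G * X).trace = (S * X * Sᵀ).trace := by
    intro X
    rw [hS, Matrix.mul_assoc, Matrix.trace_mul_comm]
  have tr2 : ∀ X : Matrix (Fin n) (Fin n) ℝ, (G * X * G * X).trace =
      ((S * X * Sᵀ) * (S * X * Sᵀ)).trace := by
    intro X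
    rw [Matrix.mul_assoc, Matrix.mul_assoc, tr1, hS]
    simp only [Matrix.mul_assoc]
  have dd : ∀ x y : Fin n → ℝ, (Sᵀ *ᵥ x) ⬝ᵥ y = x ⬝ᵥ (S *ᵥ y) := by
    intro x y
    rw [Matrix.mulVec_transpose, Matrix.dotProduct_mulVec]
  have dv : ∀ X : Matrix (Fin n) (Fin n) ℝ, v ⬝ᵥ (X *ᵥ v) =
      (S *ᵥ w) ⬝ᵥ ((S * X * Sᵀ) *ᵥ (S *ᵥ w)) := by
    intro X
    conv_lhs => rw [hv', dd]
    simp only [Matrix.mulVec_mulVec, Matrix.mul_assoc]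
  have dg : ∀ X : Matrix (Fin n) (Fin n) ℝ, (X *ᵥ v) ⬝ᵥ (G *ᵥ (X *ᵥ v)) =
      ((S * X * Sᵀ) *ᵥ (S *ᵥ w)) ⬝ᵥ ((S * X * Sᵀ) *ᵥ (S *ᵥ w)) := by
    intro X
    conv_lhs => rw [hS, ← Matrix.mulVec_mulVec, dotProduct_comm, dd, hv']
    simp only [Matrix.mulVec_mulVec, Matrix.mul_assoc]
  have sy : ∀ X : Matrix (Fin n) (Fin n) ℝ, X.IsSymm → (S * X * Sᵀ).IsSymm := by
    intro X hX
    unfold Matrix.IsSymm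
    simp only [Matrix.transpose_mul, Matrix.transpose_transpose, hX.eq, Matrix.mul_assoc]
  have hadd : S * (W + C) * Sᵀ = S * W * Sᵀ + S * C * Sᵀ := by
    rw [Matrix.mul_add, Matrix.add_mul]
  rw [dg, dv, dv, tr2, tr2, hadd]
  refine euclid_ineq m hm hn _ _ (sy W hW) (sy C hC) _ φ ?_ hpos ?_ ?_
  · rw [hφ, hv', dotProduct_comm, dd]
  · rw [← tr1, tW]
  · rw [← tr1, tC]

theorem tr_aux (A X : Matrix (Fin n) (Fin n) ℝ) :
    ∑ i, ∑ j, A i j * X i j = (A * Xᵀ).trace := by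
  simp [Matrix.trace, Matrix.mul_apply]

theorem pder_exp' {u : (Fin n → ℝ) → ℝ} {x : Fin n → ℝ} (hu : DifferentiableAt ℝ u x)
    (i : Fin n) : pder n i (fun y => Real.exp (u y)) x = Real.exp (u x) * pder n i u x := by
  unfold pder
  rw [fderiv_exp hu]
  simp

section core

variable (hΩ : IsOpen Ω) {G : (Fin n → ℝ) → Matrix (Fin n) (Fin n) ℝ}
  {F : Fin n → (Fin n → ℝ) → Matrix (Fin n) (Fin n) ℝ} {w : (Fin n → ℝ) → ℝ} {N : ℝ}
  (sG : ∀ i j, ContDiffOn ℝ (⊤ : ℕ∞) (fun y => G y i j) Ω)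
  (sF : ∀ m i j, ContDiffOn ℝ (⊤ : ℕ∞) (fun y => F m y i j) Ω)
  (sw : ContDiffOn ℝ (⊤ : ℕ∞) w Ω)
  (hG : ∀ x ∈ Ω, (G x).IsSymm)
  (hF1 : ∀ x ∈ Ω, ∀ m i j, F m x i j = F i x m j)
  (hF2 : ∀ x ∈ Ω, ∀ m i j, F m x i j = F m x j i)
  (hQ : ∀ x ∈ Ω, ∀ a m i j, pder n a (fun y => F m y i j) x = pder n m (fun y => F a y i j) x)
  (hdG : ∀ x ∈ Ω, ∀ m, (Matrix.of fun i j => pder n m (fun y => G y i j) x) =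
    - (G x * F m x * G x))
  (hL : ∀ x ∈ Ω, ∀ m, ∑ i, ∑ j, G x i j * F m x i j = - N * pder n m w x)
  (hS : ∀ x ∈ Ω, ∑ i, ∑ j, G x i j * pder n i (pder n j w) x = 0)

/-- gradient -/
noncomputable def gw (w : (Fin n → ℝ) → ℝ) (x : Fin n → ℝ) : Fin n → ℝ := fun i => pder n i w x

/-- coordinate Hessian -/
noncomputable def cW (w : (Fin n → ℝ) → ℝ) (x : Fin n → ℝ) : Matrix (Fin n) (Fin n) ℝ :=
  Matrix.of fun i j => pder n i (pder n j w) x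

/-- raised gradient -/
noncomputable def cv (G : (Fin n → ℝ) → Matrix (Fin n) (Fin n) ℝ) (w : (Fin n → ℝ) → ℝ)
    (x : Fin n → ℝ) : Fin n → ℝ := fun k => ∑ l, G x k l * pder n l w x

/-- contracted cubic form -/
noncomputable def cB (G : (Fin n → ℝ) → Matrix (Fin n) (Fin n) ℝ)
    (F : Fin n → (Fin n → ℝ) → Matrix (Fin n) (Fin n) ℝ) (w : (Fin n → ℝ) → ℝ)
    (x : Fin n → ℝ) : Matrix (Fin n) (Fin n) ℝ := ∑ m, cv G w x m • F m x

include hΩ sG sw in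
theorem s_cv (k : Fin n) : ContDiffOn ℝ (⊤ : ℕ∞) (fun y => cv G w y k) Ω :=
  ContDiffOn.sum fun l _ => (sG k l).mul (Sm.pder hΩ sw l)

include hF1 hF2 in
theorem cB_apply {x : Fin n → ℝ} (hx : x ∈ Ω) (i j : Fin n) :
    cB G F w x i j = ∑ m, F i x j m * cv G w x m := by
  simp only [cB, Matrix.sum_apply, Matrix.smul_apply, smul_eq_mul]
  refine Finset.sum_congr rfl fun m _ => ?_
  rw [hF1 x hx m i j, hF2 x hx i m j]; ring

include hΩ sG sw hF1 hF2 hdG in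
theorem pder_cv {x : Fin n → ℝ} (hx : x ∈ Ω) (j k : Fin n) :
    pder n j (fun y => cv G w y k) x = (G x * (cW w x - cB G F w x)) k j := by
  unfold cv
  rw [pder_sum' (u := fun l y => G y k l * pder n l w y)]
  swap
  · intro l _
    exact (Sm.dAt hΩ (sG k l) hx).mul (Sm.dAt hΩ (Sm.pder hΩ sw l) hx)
  have e : ∀ l, pder n j (fun y => G y k l * pder n l w y) x =
      - (G x * F j x * G x) k l * pder n l w x + G x k l * cW w x l j := by
    intro l
    rw [pder_mul' (Sm.dAt hΩ (sG k l) hx) (Sm.dAt hΩ (Sm.pder hΩ sw l) hx)]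
    have := congrFun (congrFun (hdG x hx j) k) l
    rw [Matrix.of_apply] at this
    rw [this, pder_comm' hΩ sw hx]
    rfl
  simp only [e, Finset.sum_add_distrib]
  rw [Matrix.mul_sub, Matrix.sub_apply, Matrix.mul_apply, Matrix.mul_apply]
  have e2 : ∑ l, -(G x * F j x * G x) k l * pder n l w x
      = - ((G x * F j x * G x) *ᵥ gw w x) k := by
    simp [Matrix.mulVec, dotProduct, gw]
  have e3 : G x *ᵥ gw w x = cv G w x := rfl
  rw [e2, ← Matrix.mulVec_mulVec, e3, ← Matrix.mulVec_mulVec]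
  have e4 : F j x *ᵥ cv G w x = fun l => cB G F w x l j := by
    ext l
    rw [cB_apply hF1 hF2 hx, Matrix.mulVec, dotProduct]
    refine Finset.sum_congr rfl fun m _ => ?_
    rw [hF1 x hx j l m]
  rw [e4]
  simp only [Matrix.mulVec, dotProduct]
  ring

include hG in
theorem phi_eq {x : Fin n → ℝ} (hx : x ∈ Ω) (b : Fin n → ℝ) :
    ∑ k, pder n k w x * (G x *ᵥ b) k = ∑ k, cv G w x k * b k := by
  have : gw w x ⬝ᵥ (G x *ᵥ b) = (G x *ᵥ gw w x) ⬝ᵥ b := by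
    rw [Matrix.dotProduct_mulVec, ← Matrix.mulVec_transpose, (hG x hx).eq]
  exact this

include hΩ sG sw hG hF1 hF2 hdG in
theorem pder_phi {x : Fin n → ℝ} (hx : x ∈ Ω) (j : Fin n) :
    pder n j (fun y => ∑ k, pder n k w y * cv G w y k) x =
      ∑ k, (2 * pder n j (pder n k w) x * cv G w x k) -
      ∑ k, ∑ l, F j x k l * (cv G w x k * cv G w x l) := by
  rw [pder_sum' (u := fun k y => pder n k w y * cv G w y k)]
  swap
  · intro k _
    exact (Sm.dAt hΩ (Sm.pder hΩ sw k) hx).mul (Sm.dAt hΩ (s_cv hΩ sG sw k) hx)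
  have e : ∀ k, pder n j (fun y => pder n k w y * cv G w y k) x =
      pder n j (pder n k w) x * cv G w x k +
      pder n k w x * (G x * (cW w x - cB G F w x)) k j := by
    intro k
    rw [pder_mul' (Sm.dAt hΩ (Sm.pder hΩ sw k) hx) (Sm.dAt hΩ (s_cv hΩ sG sw k) hx),
      pder_cv hΩ sG sw hF1 hF2 hdG hx]
  simp only [e, Finset.sum_add_distrib]
  have e2 : ∑ k, pder n k w x * (G x * (cW w x - cB G F w x)) k j =
      ∑ k, cv G w x k * (cW w x - cB G F w x) k j :=
    phi_eq hG hx (fun k => (cW w x - cB G F w x) k j)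
  rw [e2]
  have e3 : ∀ k, cv G w x k * (cW w x - cB G F w x) k j =
     pder n j (pder n k w) x * cv G w x k - ∑ l, F j x k l * (cv G w x k * cv G w x l) := by
    intro k
    rw [Matrix.sub_apply, cB_apply hF1 hF2 hx, mul_sub, Finset.mul_sum]
    congr 1
    · rw [pder_comm' hΩ sw hx]; simp [cW, mul_comm]
    · refine Finset.sum_congr rfl fun l _ => ?_
      rw [hF1 x hx k j l]; ring
  simp only [e3, Finset.sum_sub_distrib]
  rw [add_sub, ← Finset.sum_add_distrib]
  congr 1
  refine Finset.sum_congr rfl fun k _ => by ring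

include hΩ sG sw hG hF1 hF2 hdG in
theorem pder_phi' {x : Fin n → ℝ} (hx : x ∈ Ω) (j : Fin n) :
    pder n j (fun y => ∑ k, pder n k w y * cv G w y k) x =
      ((cW w x + (cW w x - cB G F w x)) *ᵥ cv G w x) j := by
  rw [pder_phi hΩ sG sw hG hF1 hF2 hdG hx, ← Finset.sum_sub_distrib]
  rw [Matrix.mulVec, dotProduct]
  refine Finset.sum_congr rfl fun k _ => ?_
  rw [Matrix.add_apply, Matrix.sub_apply, cB_apply hF1 hF2 hx]
  have : ∑ l, F j x k l * (cv G w x k * cv G w x l) =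
      (∑ l, F j x k l * cv G w x l) * cv G w x k := by
    rw [Finset.sum_mul]; refine Finset.sum_congr rfl fun l _ => by ring
  rw [this]
  simp only [cW, Matrix.of_apply]
  ring

include hΩ sG sF sw hG hF1 hF2 hdG in
theorem pder2_phi {x : Fin n → ℝ} (hx : x ∈ Ω) (i j : Fin n) :
    pder n i (pder n j (fun y => ∑ k, pder n k w y * cv G w y k)) x =
      2 * ∑ k, pder n i (pder n j (pder n k w)) x * cv G w x k
      - ∑ k, ∑ l, pder n i (fun y => F j y k l) x * (cv G w x k * cv G w x l)
      + 2 * ((cW w x - cB G F w x) * G x * (cW w x - cB G F w x)) j i := by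
  rw [pder_congr hΩ (fun y hy => pder_phi hΩ sG sw hG hF1 hF2 hdG hy j) hx]
  have dv : ∀ k, DifferentiableAt ℝ (fun y => cv G w y k) x :=
    fun k => Sm.dAt hΩ (s_cv hΩ sG sw k) hx
  have dw : ∀ k, DifferentiableAt ℝ (pder n j (pder n k w)) x :=
    fun k => Sm.dAt hΩ (Sm.pder hΩ (Sm.pder hΩ sw k) j) hx
  have dF : ∀ k l, DifferentiableAt ℝ (fun y => F j y k l) x :=
    fun k l => Sm.dAt hΩ (sF j k l) hx
  have d1 : ∀ k, DifferentiableAt ℝ (fun y => 2 * pder n j (pder n k w) y * cv G w y k) x :=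
    fun k => ((differentiableAt_const _).fun_mul (dw k)).fun_mul (dv k)
  have d2 : ∀ k l, DifferentiableAt ℝ (fun y => F j y k l * (cv G w y k * cv G w y l)) x :=
    fun k l => (dF k l).fun_mul ((dv k).fun_mul (dv l))
  rw [pder_sub' (DifferentiableAt.fun_sum fun k _ => d1 k)
    (DifferentiableAt.fun_sum fun k _ => DifferentiableAt.fun_sum fun l _ => d2 k l),
    pder_sum' (fun k _ => d1 k),
    pder_sum' (fun k _ => DifferentiableAt.fun_sum fun l _ => d2 k l)]
  have e1 : ∀ k, pder n i (fun y => 2 * pder n j (pder n k w) y * cv G w y k) x =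
      2 * (pder n i (pder n j (pder n k w)) x * cv G w x k) +
      2 * (cW w x j k * (G x * (cW w x - cB G F w x)) k i) := by
    intro k
    rw [pder_mul' ((differentiableAt_const _).fun_mul (dw k)) (dv k), pder_cmul' (dw k),
      pder_cv hΩ sG sw hF1 hF2 hdG hx]
    simp only [cW, Matrix.of_apply]; ring
  set C := cW w x - cB G F w x with hC
  have e2 : ∀ k, pder n i (fun y => ∑ l, F j y k l * (cv G w y k * cv G w y l)) x =
      ∑ l, pder n i (fun y => F j y k l) x * (cv G w x k * cv G w x l) +
      (∑ l, F j x k l * cv G w x l * (G x * C) k i +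
       ∑ l, F j x l k * cv G w x k * (G x * C) l i) := by
    intro k
    rw [pder_sum' (fun l _ => d2 k l), ← Finset.sum_add_distrib, ← Finset.sum_add_distrib]
    refine Finset.sum_congr rfl fun l _ => ?_
    rw [pder_mul' (dF k l) ((dv k).fun_mul (dv l)), pder_mul' (dv k) (dv l),
      pder_cv hΩ sG sw hF1 hF2 hdG hx, pder_cv hΩ sG sw hF1 hF2 hdG hx, hF2 x hx j l k]
    ring
  have e3 : ∑ k, ∑ l, F j x l k * cv G w x k * (G x * C) l i =
      ∑ k, cB G F w x j k * (G x * C) k i := by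
    rw [Finset.sum_comm]
    refine Finset.sum_congr rfl fun k _ => ?_
    rw [cB_apply hF1 hF2 hx, Finset.sum_mul]
  have e4 : ∑ k, ∑ l, F j x k l * cv G w x l * (G x * C) k i =
      ∑ k, cB G F w x j k * (G x * C) k i := by
    refine Finset.sum_congr rfl fun k _ => ?_
    rw [cB_apply hF1 hF2 hx, Finset.sum_mul]
  simp only [e1, e2, Finset.sum_add_distrib, e3, e4]
  have e5 : (C * G x * C) j i = ∑ k, cW w x j k * (G x * C) k i -
      ∑ k, cB G F w x j k * (G x * C) k i := by
    rw [Matrix.mul_assoc, Matrix.mul_apply, ← Finset.sum_sub_distrib]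
    refine Finset.sum_congr rfl fun k _ => ?_
    nth_rw 1 [hC]
    rw [Matrix.sub_apply]; ring
  rw [e5, ← Finset.mul_sum, ← Finset.mul_sum]
  ring

include hΩ sw in
theorem cW_symm {x : Fin n → ℝ} (hx : x ∈ Ω) : (cW w x).IsSymm := by
  ext i j; exact pder_comm' hΩ sw hx _ _

include hF1 hF2 in
theorem cB_symm {x : Fin n → ℝ} (hx : x ∈ Ω) : (cB G F w x).IsSymm := by
  ext i j
  rw [Matrix.transpose_apply, cB_apply hF1 hF2 hx, cB_apply hF1 hF2 hx]
  refine Finset.sum_congr rfl fun k _ => by rw [hF1 x hx]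

include hΩ sG sF sw hG hF1 hF2 hQ hdG hL hS in
theorem contracted {x : Fin n → ℝ} (hx : x ∈ Ω) :
    ∑ i, ∑ j, G x i j * pder n i (pder n j (fun y => ∑ k, pder n k w y * cv G w y k)) x =
      (G x * cW w x * G x * cW w x).trace
      + (G x * (cW w x - cB G F w x) * G x * (cW w x - cB G F w x)).trace
      + N * (cv G w x ⬝ᵥ (cW w x *ᵥ cv G w x)) := by
  set C := cW w x - cB G F w x with hC
  have dG : ∀ i j, DifferentiableAt ℝ (fun y => G y i j) x := fun i j => Sm.dAt hΩ (sG i j) hx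
  have dF : ∀ m i j, DifferentiableAt ℝ (fun y => F m y i j) x :=
    fun m i j => Sm.dAt hΩ (sF m i j) hx
  have dw : ∀ i, DifferentiableAt ℝ (pder n i w) x := fun i => Sm.dAt hΩ (Sm.pder hΩ sw i) hx
  have dw2 : ∀ i j, DifferentiableAt ℝ (pder n i (pder n j w)) x :=
    fun i j => Sm.dAt hΩ (Sm.pder hΩ (Sm.pder hΩ sw j) i) hx
  have hdG' : ∀ m i j, pder n m (fun y => G y i j) x = - (G x * F m x * G x) i j := by
    intro m i j
    have := congrFun (congrFun (hdG x hx m) i) j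
    rwa [Matrix.of_apply] at this
  -- derivative of the scalar-flat equation
  have k1 : ∀ k, ∑ i, ∑ j, G x i j * pder n k (pder n i (pder n j w)) x =
      (G x * F k x * G x * cW w x).trace := by
    intro k
    have h : pder n k (fun y => ∑ i, ∑ j, G y i j * pder n i (pder n j w) y) x = 0 := by
      rw [pder_congr hΩ hS hx, pder_const']
    rw [pder_sum' (fun i _ => DifferentiableAt.fun_sum fun j _ => (dG i j).fun_mul (dw2 i j))] at h
    have e : ∀ i, pder n k (fun y => ∑ j, G y i j * pder n i (pder n j w) y) x =
        - ∑ j, (G x * F k x * G x) i j * cW w x i j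
        + ∑ j, G x i j * pder n k (pder n i (pder n j w)) x := by
      intro i
      rw [pder_sum' (fun j _ => (dG i j).fun_mul (dw2 i j)), ← Finset.sum_neg_distrib,
        ← Finset.sum_add_distrib]
      refine Finset.sum_congr rfl fun j _ => ?_
      rw [pder_mul' (dG i j) (dw2 i j), hdG']
      simp [cW]
    simp only [e, Finset.sum_add_distrib, Finset.sum_neg_distrib] at h
    rw [tr_aux, (cW_symm hΩ sw hx).eq] at h
    linarith
  have k2 : ∀ k l, ∑ i, ∑ j, G x i j * pder n k (fun y => F l y i j) x =
      (G x * F k x * G x * F l x).trace - N * cW w x k l := by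
    intro k l
    have h : pder n k (fun y => ∑ i, ∑ j, G y i j * F l y i j) x = - N * cW w x k l := by
      rw [pder_congr hΩ (fun y hy => hL y hy l) hx, pder_cmul' (dw l)]
      rfl
    rw [pder_sum' (fun i _ => DifferentiableAt.fun_sum fun j _ => (dG i j).fun_mul (dF l i j))] at h
    have e : ∀ i, pder n k (fun y => ∑ j, G y i j * F l y i j) x =
        - ∑ j, (G x * F k x * G x) i j * F l x i j
        + ∑ j, G x i j * pder n k (fun y => F l y i j) x := by
      intro i
      rw [pder_sum' (fun j _ => (dG i j).fun_mul (dF l i j)), ← Finset.sum_neg_distrib,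
        ← Finset.sum_add_distrib]
      refine Finset.sum_congr rfl fun j _ => ?_
      rw [pder_mul' (dG i j) (dF l i j), hdG']
      ring
    simp only [e, Finset.sum_add_distrib, Finset.sum_neg_distrib] at h
    have hFs : (F l x)ᵀ = F l x := by ext i j; exact hF2 x hx _ _ _
    rw [tr_aux, hFs] at h
    linarith
  have z1 : ∑ i, ∑ j, G x i j * ∑ k, pder n i (pder n j (pder n k w)) x * cv G w x k =
      (G x * cB G F w x * G x * cW w x).trace := by
    have : (G x * cB G F w x * G x * cW w x).trace =
        ∑ k, cv G w x k * (G x * F k x * G x * cW w x).trace := by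
      simp [cB, Matrix.mul_sum, Matrix.sum_mul, Matrix.trace_sum]
    rw [this]
    simp only [← k1, Finset.mul_sum]
    conv_rhs => rw [Finset.sum_comm]; enter [2, i]; rw [Finset.sum_comm]
    refine Finset.sum_congr rfl fun i _ => Finset.sum_congr rfl fun j _ =>
      Finset.sum_congr rfl fun k _ => ?_
    have : pder n i (pder n j (pder n k w)) x = pder n k (pder n i (pder n j w)) x := by
      rw [pder_congr hΩ (fun y hy => pder_comm' hΩ sw hy j k) hx,
        pder_comm' hΩ (Sm.pder hΩ sw j) hx i k]
    rw [this]; ring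
  have z2 : ∑ i, ∑ j, G x i j * ∑ k, ∑ l, pder n i (fun y => F j y k l) x *
        (cv G w x k * cv G w x l) =
      (G x * cB G F w x * G x * cB G F w x).trace - N * (cv G w x ⬝ᵥ (cW w x *ᵥ cv G w x)) := by
    have h1 : (G x * cB G F w x * G x * cB G F w x).trace =
        ∑ k, ∑ l, cv G w x k * cv G w x l * (G x * F k x * G x * F l x).trace := by
      rw [Finset.sum_comm]
      simp only [cB, Matrix.mul_sum, Matrix.sum_mul, Matrix.trace_sum, Matrix.mul_smul,
        Matrix.smul_mul, Matrix.trace_smul, smul_eq_mul, Finset.mul_sum]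
      refine Finset.sum_congr rfl fun k _ => Finset.sum_congr rfl fun l _ => by ring
    have h2 : N * (cv G w x ⬝ᵥ (cW w x *ᵥ cv G w x)) =
        ∑ k, ∑ l, cv G w x k * cv G w x l * (N * cW w x k l) := by
      simp only [dotProduct, Matrix.mulVec, Finset.mul_sum]
      refine Finset.sum_congr rfl fun k _ => Finset.sum_congr rfl fun l _ => by ring
    rw [h1, h2]
    simp only [← Finset.sum_sub_distrib, ← mul_sub, ← k2, Finset.mul_sum]
    have sw4 : ∀ X : Fin n → Fin n → Fin n → Fin n → ℝ,
        ∑ k, ∑ l, ∑ i, ∑ j, X k l i j = ∑ i, ∑ j, ∑ k, ∑ l, X k l i j := by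
      intro X
      calc ∑ k, ∑ l, ∑ i, ∑ j, X k l i j = ∑ k, ∑ i, ∑ l, ∑ j, X k l i j :=
            Finset.sum_congr rfl fun k _ => Finset.sum_comm
        _ = ∑ i, ∑ k, ∑ l, ∑ j, X k l i j := Finset.sum_comm
        _ = ∑ i, ∑ k, ∑ j, ∑ l, X k l i j :=
            Finset.sum_congr rfl fun i _ => Finset.sum_congr rfl fun k _ => Finset.sum_comm
        _ = _ := Finset.sum_congr rfl fun i _ => Finset.sum_comm
    rw [sw4]
    refine Finset.sum_congr rfl fun i _ => Finset.sum_congr rfl fun j _ =>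
      Finset.sum_congr rfl fun k _ => Finset.sum_congr rfl fun l _ => ?_
    have : pder n i (fun y => F j y k l) x = pder n k (fun y => F l y i j) x := by
      rw [pder_congr hΩ (v := fun y => F k y j l) (fun y hy => hF1 y hy j k l) hx,
        hQ x hx i k j l]
      refine pder_congr hΩ (fun y hy => ?_) hx k
      rw [hF2 y hy i j l, hF1 y hy i l j]
    rw [this]; ring
  have z3 : ∑ i, ∑ j, G x i j * (C * G x * C) j i = (G x * C * G x * C).trace := by
    have : G x * C * G x * C = G x * (C * G x * C) := by simp only [Matrix.mul_assoc]
    rw [this]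
    simp [Matrix.trace, Matrix.mul_apply]
  have e : ∀ i j, G x i j * pder n i (pder n j (fun y => ∑ k, pder n k w y * cv G w y k)) x =
      2 * (G x i j * ∑ k, pder n i (pder n j (pder n k w)) x * cv G w x k)
      - G x i j * (∑ k, ∑ l, pder n i (fun y => F j y k l) x * (cv G w x k * cv G w x l))
      + 2 * (G x i j * (C * G x * C) j i) := by
    intro i j
    rw [pder2_phi hΩ sG sF sw hG hF1 hF2 hdG hx]
    ring
  simp only [e, Finset.sum_add_distrib, Finset.sum_sub_distrib, ← Finset.mul_sum]
  rw [z1, z2, z3]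
  have hB : cB G F w x = cW w x - C := by rw [hC]; abel
  rw [hB]
  have cyc : (G x * C * G x * cW w x).trace = (G x * cW w x * G x * C).trace := by
    rw [Matrix.mul_assoc, Matrix.trace_mul_comm, ← Matrix.mul_assoc]
  simp only [Matrix.mul_sub, Matrix.sub_mul, Matrix.trace_sub]
  rw [cyc]
  ring

include hF2 hL in
theorem trace_B {x : Fin n → ℝ} (hx : x ∈ Ω) :
    (G x * cB G F w x).trace = - N * ∑ k, pder n k w x * cv G w x k := by
  have hFs : ∀ l, (F l x)ᵀ = F l x := by intro l; ext i j; exact hF2 x hx _ _ _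
  have : ∀ l, (G x * F l x).trace = - N * pder n l w x := by
    intro l
    rw [← hL x hx l, tr_aux, hFs]
  simp only [cB, Matrix.mul_sum, Matrix.trace_sum, Matrix.mul_smul, Matrix.trace_smul, this,
    smul_eq_mul, Finset.mul_sum]
  refine Finset.sum_congr rfl fun k _ => by ring

include hΩ sG sw hF1 hF2 hdG hL in
theorem lap_core {u s : (Fin n → ℝ) → ℝ} (su : ContDiffOn ℝ (⊤ : ℕ∞) u Ω)
    (hs : ∀ x ∈ Ω, s x = Real.exp (- (N / 2) * w x)) {x : Fin n → ℝ} (hx : x ∈ Ω) :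
    ∑ i, pder n i (fun y => s y * ∑ j, G y i j * pder n j u y) x =
      s x * (∑ i, ∑ j, G x i j * pder n i (pder n j u) x +
        N / 2 * ∑ i, ∑ j, G x i j * pder n i w x * pder n j u x) := by
  have dG : ∀ i j, DifferentiableAt ℝ (fun y => G y i j) x := fun i j => Sm.dAt hΩ (sG i j) hx
  have du : ∀ i, DifferentiableAt ℝ (pder n i u) x := fun i => Sm.dAt hΩ (Sm.pder hΩ su i) hx
  have dw : DifferentiableAt ℝ w x := Sm.dAt hΩ sw hx
  have hdG' : ∀ m i j, pder n m (fun y => G y i j) x = - (G x * F m x * G x) i j := by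
    intro m i j
    have := congrFun (congrFun (hdG x hx m) i) j
    rwa [Matrix.of_apply] at this
  have ds : DifferentiableAt ℝ (fun y => Real.exp (- (N / 2) * w y)) x :=
    ((differentiableAt_const _).fun_mul dw).exp
  have e : ∀ i, pder n i (fun y => s y * ∑ j, G y i j * pder n j u y) x =
      s x * (- (N / 2) * ∑ j, G x i j * pder n i w x * pder n j u x
        - ∑ j, (G x * F i x * G x) i j * pder n j u x
        + ∑ j, G x i j * pder n i (pder n j u) x) := by
    intro i
    rw [pder_congr hΩ (v := fun y => Real.exp (- (N / 2) * w y) * ∑ j, G y i j * pder n j u y)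
      (fun y hy => by rw [hs y hy]) hx]
    rw [pder_mul' ds (DifferentiableAt.fun_sum fun j _ => (dG i j).fun_mul (du j)),
      pder_sum' (fun j _ => (dG i j).fun_mul (du j)),
      pder_exp' (u := fun y => - (N / 2) * w y) ((differentiableAt_const _).fun_mul dw),
      pder_cmul' dw, ← hs x hx]
    simp only [pder_mul' (dG i _) (du _), hdG', Finset.sum_add_distrib, neg_mul,
      Finset.sum_neg_distrib]
    have : ∑ j, G x i j * pder n i w x * pder n j u x =
        pder n i w x * ∑ j, G x i j * pder n j u x := by
      rw [Finset.mul_sum]; refine Finset.sum_congr rfl fun j _ => by ring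
    rw [this]; ring
  simp only [e, ← Finset.mul_sum, Finset.sum_add_distrib, Finset.sum_sub_distrib]
  have key : ∑ i, ∑ j, (G x * F i x * G x) i j * pder n j u x =
      - N * ∑ i, ∑ j, G x i j * pder n i w x * pder n j u x := by
    have h1 : ∀ b, ∑ i, (G x * F i x) i b = - N * pder n b w x := by
      intro b
      rw [← hL x hx b]
      refine Finset.sum_congr rfl fun i _ => ?_
      rw [Matrix.mul_apply]
      refine Finset.sum_congr rfl fun a _ => ?_
      rw [hF2 x hx i a b, hF1 x hx i b a]
    rw [Finset.sum_comm, Finset.mul_sum]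
    calc ∑ j, ∑ i, (G x * F i x * G x) i j * pder n j u x
        = ∑ j, ∑ b, (∑ i, (G x * F i x) i b) * (G x b j * pder n j u x) := by
          refine Finset.sum_congr rfl fun j _ => ?_
          simp only [Finset.sum_mul]
          rw [Finset.sum_comm]
          refine Finset.sum_congr rfl fun i _ => ?_
          rw [Matrix.mul_apply, Finset.sum_mul]
          refine Finset.sum_congr rfl fun b _ => by ring
      _ = ∑ b, ∑ j, (∑ i, (G x * F i x) i b) * (G x b j * pder n j u x) := Finset.sum_comm
      _ = _ := by
          refine Finset.sum_congr rfl fun b _ => ?_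
          rw [h1, Finset.mul_sum]
          refine Finset.sum_congr rfl fun j _ => by ring
  rw [key]
  ring

end core

theorem hess_smooth (hΩ : IsOpen Ω) {f : (Fin n → ℝ) → ℝ} (hf : ContDiffOn ℝ (⊤ : ℕ∞) f Ω)
    (i j : Fin n) : ContDiffOn ℝ (⊤ : ℕ∞) (fun y => Hess n f y i j) Ω :=
  Sm.pder hΩ (Sm.pder hΩ hf j) i

/-- derivative of the Hessian -/
noncomputable def cF (f : (Fin n → ℝ) → ℝ) (m : Fin n) (x : Fin n → ℝ) :
    Matrix (Fin n) (Fin n) ℝ := Matrix.of fun i j => pder n m (fun y => Hess n f y i j) x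

theorem Phi_eq (hΩ : IsOpen Ω) {f : (Fin n → ℝ) → ℝ}
    (sw : ContDiffOn ℝ (⊤ : ℕ∞) (fun y => Real.log (rho n f y)) Ω)
    (hr : ∀ x ∈ Ω, 0 < rho n f x) {x : Fin n → ℝ} (hx : x ∈ Ω) :
    Phi n f x = ∑ k, pder n k (fun y => Real.log (rho n f y)) x *
      cv (fun y => (Hess n f y)⁻¹) (fun y => Real.log (rho n f y)) x k := by
  have h : ∀ i, pder n i (rho n f) x =
      rho n f x * pder n i (fun y => Real.log (rho n f y)) x := by
    intro i
    rw [pder_congr hΩ (v := fun y => Real.exp (Real.log (rho n f y)))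
      (fun y hy => (Real.exp_log (hr y hy)).symm) hx,
      pder_exp' (u := fun y => Real.log (rho n f y)) (Sm.dAt hΩ sw hx), Real.exp_log (hr x hx)]
  have hne := (hr x hx).ne'
  unfold Phi gradInner cv
  rw [div_eq_iff (by positivity), Finset.sum_mul]
  refine Finset.sum_congr rfl fun i _ => ?_
  rw [Finset.mul_sum, Finset.sum_mul]
  refine Finset.sum_congr rfl fun j _ => ?_
  rw [h, h]; ring

end helpers

/-- **Proposition 2 (paper).** For a potential `f` on `Ω ⊆ ℝⁿ` (`n ≥ 2`) with vanishing
affine Kähler scalar curvature, at every point where `Φ > 0`,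
`Δ_g Φ ≥ (n/(2(n−1)))‖∇Φ‖²_g/Φ + ((n²−4)/(n−1))⟨∇Φ, ∇log ρ⟩_g
  + ((n+2)²/2)(1/(n−1) − (n−1)/(4n))Φ²`. -/
theorem laplacian_Phi_estimate_scalar_flat
    (n : ℕ) (hn : 2 ≤ n) (Ω : Set (Fin n → ℝ)) (hΩ : IsOpen Ω)
    (f : (Fin n → ℝ) → ℝ) (hf : ContDiffOn ℝ (⊤ : ℕ∞) f Ω)
    (hpos : ∀ x ∈ Ω, (Hess n f x).PosDef)
    (hscal : ∀ x ∈ Ω,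
      -(1 / 2 : ℝ) * ∑ i, ∑ j, (Hess n f x)⁻¹ i j *
        pder n i (pder n j (fun y => Real.log (Hess n f y).det)) x = 0) :
    ∀ p ∈ Ω, 0 < Phi n f p →
      lapBel n f (Phi n f) p ≥
        ((n : ℝ) / (2 * ((n : ℝ) - 1))) *
          gradInner n f (Phi n f) (Phi n f) p / Phi n f p +
        (((n : ℝ) ^ 2 - 4) / ((n : ℝ) - 1)) *
          gradInner n f (Phi n f) (fun y => Real.log (rho n f y)) p +
        (((n : ℝ) + 2) ^ 2 / 2) * (1 / ((n : ℝ) - 1) - ((n : ℝ) - 1) / (4 * (n : ℝ))) *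
          (Phi n f p) ^ 2 := by
  intro p hp hPhi
  set N : ℝ := (n : ℝ) + 2 with hN
  have hNpos : 0 < N := by positivity
  have hNne : N ≠ 0 := hNpos.ne'
  have sH := hess_smooth hΩ hf
  have hdet : ∀ x ∈ Ω, 0 < (Hess n f x).det := fun x hx => (hpos x hx).det_pos
  have hdne : ∀ x ∈ Ω, (Hess n f x).det ≠ 0 := fun x hx => (hdet x hx).ne'
  have sG := Sm.inv sH hdne
  have sD := Sm.det sH
  have sL : ContDiffOn ℝ (⊤ : ℕ∞) (fun y => Real.log (Hess n f y).det) Ω := sD.log hdne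
  have hr : ∀ x ∈ Ω, 0 < rho n f x := fun x hx => Real.rpow_pos_of_pos (hdet x hx) _
  have hw : ∀ x ∈ Ω, Real.log (rho n f x) = (-1 / N) * Real.log (Hess n f x).det := by
    intro x hx
    rw [rho, Real.log_rpow (hdet x hx)]
  have sw : ContDiffOn ℝ (⊤ : ℕ∞) (fun y => Real.log (rho n f y)) Ω :=
    (contDiffOn_const.mul sL).congr hw
  have hLw : ∀ x ∈ Ω, Real.log (Hess n f x).det = - N * Real.log (rho n f x) := by
    intro x hx
    rw [hw x hx]; field_simp
  set w : (Fin n → ℝ) → ℝ := fun y => Real.log (rho n f y) with hwdef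
  have hsymH : ∀ x ∈ Ω, (Hess n f x).IsSymm := by
    intro x hx
    ext i j
    exact pder_comm' hΩ hf hx _ _
  have hsymG : ∀ x ∈ Ω, ((Hess n f x)⁻¹).IsSymm := by
    intro x hx
    unfold Matrix.IsSymm
    rw [Matrix.transpose_nonsing_inv, (hsymH x hx).eq]
  have sF : ∀ m i j, ContDiffOn ℝ (⊤ : ℕ∞) (fun y => cF f m y i j) Ω :=
    fun m i j => Sm.pder hΩ (sH i j) m
  have hF1 : ∀ x ∈ Ω, ∀ m i j, cF f m x i j = cF f i x m j :=
    fun x hx m i j => pder_comm' hΩ (Sm.pder hΩ hf j) hx m i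
  have hF2 : ∀ x ∈ Ω, ∀ m i j, cF f m x i j = cF f m x j i :=
    fun x hx m i j => pder_congr hΩ (fun y hy => pder_comm' hΩ hf hy i j) hx m
  have hQ : ∀ x ∈ Ω, ∀ a m i j, pder n a (fun y => cF f m y i j) x =
      pder n m (fun y => cF f a y i j) x :=
    fun x hx a m i j => pder_comm' hΩ (sH i j) hx a m
  have hdG : ∀ x ∈ Ω, ∀ m, (Matrix.of fun i j => pder n m (fun y => (Hess n f y)⁻¹ i j) x) =
      - ((Hess n f x)⁻¹ * cF f m x * (Hess n f x)⁻¹) :=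
    fun x hx m => pder_inv hΩ sH hdne hx m
  have hL : ∀ x ∈ Ω, ∀ m, ∑ i, ∑ j, (Hess n f x)⁻¹ i j * cF f m x i j = - N * pder n m w x := by
    intro x hx m
    have h1 : pder n m (fun y => Real.log (Hess n f y).det) x = - N * pder n m w x := by
      rw [pder_congr hΩ hLw hx, pder_cmul' (u := w) (Sm.dAt hΩ sw hx)]
    have h2 : pder n m (fun y => Real.log (Hess n f y).det) x =
        ((Hess n f x).det)⁻¹ * pder n m (fun y => (Hess n f y).det) x := by
      unfold pder
      rw [fderiv.log (Sm.dAt hΩ sD hx) (hdne x hx)]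
      simp
    rw [← h1, h2, pder_det (fun i j => Sm.dAt hΩ (sH i j) hx), Finset.mul_sum]
    refine Finset.sum_congr rfl fun i _ => ?_
    rw [Finset.mul_sum]
    refine Finset.sum_congr rfl fun j _ => ?_
    rw [hF2 x hx m i j, Matrix.inv_def, Matrix.smul_apply, Ring.inverse_eq_inv', smul_eq_mul,
      mul_assoc]
    rfl
  have hS : ∀ x ∈ Ω, ∑ i, ∑ j, (Hess n f x)⁻¹ i j * pder n i (pder n j w) x = 0 := by
    intro x hx
    have h := hscal x hx
    have e : ∀ i j, pder n i (pder n j (fun y => Real.log (Hess n f y).det)) x =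
        - N * pder n i (pder n j w) x := by
      intro i j
      rw [pder_congr hΩ (v := fun y => - N * pder n j w y) _ hx,
        pder_cmul' (Sm.dAt hΩ (Sm.pder hΩ sw j) hx)]
      intro y hy
      rw [pder_congr hΩ hLw hy, pder_cmul' (u := w) (Sm.dAt hΩ sw hy)]
    simp only [e] at h
    have e2 : ∑ i, ∑ j, (Hess n f x)⁻¹ i j * (- N * pder n i (pder n j w) x) =
        - N * ∑ i, ∑ j, (Hess n f x)⁻¹ i j * pder n i (pder n j w) x := by
      simp only [Finset.mul_sum]
      refine Finset.sum_congr rfl fun i _ => Finset.sum_congr rfl fun j _ => by ring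
    rw [e2, ← mul_assoc] at h
    exact (mul_eq_zero.1 h).resolve_left (by simp [hNne])
  set G : (Fin n → ℝ) → Matrix (Fin n) (Fin n) ℝ := fun y => (Hess n f y)⁻¹ with hGdef
  set φ : (Fin n → ℝ) → ℝ := fun y => ∑ k, pder n k w y * cv G w y k with hφ
  have hPφ : ∀ x ∈ Ω, Phi n f x = φ x := fun x hx => Phi_eq hΩ sw hr hx
  have sφ : ContDiffOn ℝ (⊤ : ℕ∞) φ Ω :=
    ContDiffOn.sum fun k _ => (Sm.pder hΩ sw k).mul (s_cv hΩ sG sw k)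
  have sPhi : ContDiffOn ℝ (⊤ : ℕ∞) (Phi n f) Ω := sφ.congr hPφ
  have hgrad : ∀ x ∈ Ω, ∀ j, pder n j (Phi n f) x = pder n j φ x :=
    fun x hx j => pder_congr hΩ hPφ hx j
  have hs : ∀ x ∈ Ω, (Hess n f x).det ^ ((1 : ℝ) / 2) = Real.exp (- (N / 2) * w x) := by
    intro x hx
    rw [Real.rpow_def_of_pos (hdet x hx), hLw x hx]
    congr 1; ring
  have hlap : lapBel n f (Phi n f) p =
      ∑ i, ∑ j, G p i j * pder n i (pder n j φ) p +
        N / 2 * ∑ i, ∑ j, G p i j * pder n i w p * pder n j φ p := by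
    unfold lapBel
    rw [lap_core (G := G) (F := cF f) (w := w) (N := N) hΩ sG sw hF1 hF2 hdG hL sPhi hs hp,
      ← mul_assoc, ← Real.rpow_add (hdet p hp)]
    have : (-(1 : ℝ) / 2 + 1 / 2) = 0 := by norm_num
    rw [this, Real.rpow_zero, one_mul]
    simp only [hgrad p hp]
    have : ∀ i j, pder n i (pder n j (Phi n f)) p = pder n i (pder n j φ) p :=
      fun i j => pder_congr hΩ (fun y hy => hgrad y hy j) hp i
    simp only [this]
  set W := cW w p with hW
  set C := cW w p - cB G (cF f) w p with hC
  set v := cv G w p with hv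
  have hgφ : ∀ j, pder n j φ p = ((W + C) *ᵥ v) j :=
    fun j => pder_phi' (F := cF f) hΩ sG sw hsymG hF1 hF2 hdG hp j
  have hvw : v = G p *ᵥ gw w p := rfl
  have g1 : gradInner n f (Phi n f) (Phi n f) p = ((W + C) *ᵥ v) ⬝ᵥ (G p *ᵥ ((W + C) *ᵥ v)) := by
    unfold gradInner
    simp only [hgrad p hp, hgφ]
    generalize (W + C) *ᵥ v = b
    simp only [dotProduct, Matrix.mulVec, Finset.mul_sum]
    refine Finset.sum_congr rfl fun i _ => Finset.sum_congr rfl fun j _ => ?_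
    simp only [hGdef]; ring
  have g3 : ∑ i, ∑ j, G p i j * pder n i w p * pder n j φ p = v ⬝ᵥ ((W + C) *ᵥ v) := by
    have h := phi_eq (G := G) (w := w) hsymG hp ((W + C) *ᵥ v)
    rw [dotProduct, ← h]
    refine Finset.sum_congr rfl fun i _ => ?_
    conv_rhs => rw [Matrix.mulVec, dotProduct, Finset.mul_sum]
    refine Finset.sum_congr rfl fun j _ => ?_
    rw [hgφ]; ring
  have g2 : gradInner n f (Phi n f) w p = v ⬝ᵥ ((W + C) *ᵥ v) := by
    unfold gradInner
    simp only [hgrad p hp]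
    rw [← g3, Finset.sum_comm]
    refine Finset.sum_congr rfl fun i _ => Finset.sum_congr rfl fun j _ => ?_
    have : G p i j = (Hess n f p)⁻¹ j i := ((hsymG p hp).apply i j).symm
    rw [this]; ring
  have hcon := contracted (G := G) (F := cF f) (w := w) (N := N) hΩ sG sF sw hsymG hF1 hF2 hQ
    hdG hL hS hp
  have hWs : W.IsSymm := cW_symm hΩ sw hp
  have hBs : (cB G (cF f) w p).IsSymm := cB_symm (F := cF f) hF1 hF2 hp
  have hCs : C.IsSymm := hWs.sub hBs
  have tW : (G p * W).trace = 0 := by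
    rw [← hS p hp]
    have := tr_aux (G p) W
    rw [hWs.eq] at this
    rw [← this]
    rfl
  have tC : (G p * C).trace = N * φ p := by
    have := trace_B (G := G) (F := cF f) (w := w) (N := N) hF2 hL hp
    rw [hC, Matrix.mul_sub, Matrix.trace_sub, this, tW]
    simp only [hφ]; ring
  have hmain := metric_ineq (n := n) (n : ℝ) rfl (by exact_mod_cast hn) (G p) W C
    (hpos p hp).inv.posSemidef hWs hCs (gw w p) v (φ p) hvw rfl (by rw [← hPφ p hp]; exact hPhi)
    tW tC
  rw [hlap, hcon, g1, g2, g3, hPφ p hp]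
  exact hmain
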